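/- Fix μ ∈ (1/2,1) and r > 0. For t > 0 let ω_t be the Kaden vorticity (the pushforward under γ_t(s) = s·exp(i·(t/(2π))·s^{−1/μ}) of the measure (2 − 1/μ)·s^{1−1/μ} ds on (0,∞)), and let u(t) be the Biot-Savart velocity of ω_t. Then for every t₀ ∈ (0,∞), lim_{t→t₀} ∫_{B(0,r)} |u(t)(x) − u(t₀)(x)|² dx = 0; in particular the function t ↦ E_r(ω_t) is continuous on (0,∞). -/

import Mathlib

open MeasureTheory Metric Real Filter
open scoped ENNReal NNReal Topology

/-- Biot-Savart velocity field of a vorticity measure `ω` on `ℂ = ℝ²`: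
`v(z) = (2π)⁻¹ ∫ i (z - u) / |z - u|² dω(u)`. -/
noncomputable def biotSavart (ω : Measure ℂ) (z : ℂ) : ℂ :=
  (2 * π)⁻¹ • ∫ u, Complex.I * (z - u) / (((‖z - u‖ : ℝ) : ℂ) ^ 2) ∂ω

/-- Local kinetic energy `E_r(ω) = ∫_{B(0,r)} |v|²`. -/
noncomputable def localEnergy (ω : Measure ℂ) (r : ℝ) : ℝ≥0∞ :=
  ∫⁻ x in ball (0 : ℂ) r, (‖biotSavart ω x‖₊ : ℝ≥0∞) ^ 2

/-- Spherical average `A_r(ω) = (2π)⁻¹ ∫_0^{2π} |v(r e^{iθ})|² dθ`. -/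
noncomputable def sphAvg (ω : Measure ℂ) (r : ℝ) : ℝ≥0∞ :=
  (ENNReal.ofReal (2 * π))⁻¹ *
    ∫⁻ θ in Set.Ioo (0 : ℝ) (2 * π),
      (‖biotSavart ω ((r : ℂ) * Complex.exp ((θ : ℂ) * Complex.I))‖₊ : ℝ≥0∞) ^ 2

/-- Inner moments `m_{r,n}(ω) = ∫_{B(0,r)} uⁿ dω(u)` (for `n = 0` this is `ω(B(0,r))`). -/
noncomputable def innerMoment (ω : Measure ℂ) (r : ℝ) (n : ℕ) : ℂ :=
  ∫ u in ball (0 : ℂ) r, u ^ n ∂ω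

/-- Outer moments `M_{r,k}(ω) = ∫_{ℂ ∖ B(0,r)} u⁻ᵏ dω(u)`. -/
noncomputable def outerMoment (ω : Measure ℂ) (r : ℝ) (k : ℕ) : ℂ :=
  ∫ u in (ball (0 : ℂ) r)ᶜ, u ^ (-(k : ℤ)) ∂ω

/-- The parametrization of the Kaden spiral: `γ_t(s) = s·exp(i·(t/(2π))·s^{-1/μ})`. -/
noncomputable def kadenCurve (μ t s : ℝ) : ℂ :=
  (s : ℂ) * Complex.exp (Complex.I * ((t / (2 * π) * s ^ (-1 / μ) : ℝ) : ℂ))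

/-- The Kaden vorticity `ω_t`: the pushforward under `γ_t` of the measure
`(2 - 1/μ)·s^{1-1/μ} ds` on `(0,∞)`. -/
noncomputable def kadenMeasure (μ t : ℝ) : Measure ℂ :=
  Measure.map (kadenCurve μ t)
    (((volume : Measure ℝ).restrict (Set.Ioi 0)).withDensity
      (fun s => ENNReal.ofReal ((2 - 1 / μ) * s ^ (1 - 1 / μ))))

theorem norm_circleMap_sub_comm (ρ s θ φ : ℝ) :
    ‖circleMap 0 ρ θ - circleMap 0 s φ‖ = ‖circleMap 0 s θ - circleMap 0 ρ φ‖ := by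
  rw [← sq_eq_sq₀ (norm_nonneg _) (norm_nonneg _), ← Complex.normSq_eq_norm_sq,
    ← Complex.normSq_eq_norm_sq, Complex.normSq_apply, Complex.normSq_apply]
  simp only [circleMap, zero_add, Complex.sub_re, Complex.sub_im, Complex.re_ofReal_mul,
    Complex.im_ofReal_mul, Complex.exp_ofReal_mul_I_re, Complex.exp_ofReal_mul_I_im]
  linear_combination (ρ ^ 2 - s ^ 2) * (Real.sin_sq_add_cos_sq θ - Real.sin_sq_add_cos_sq φ)

theorem integral_inv_sq_norm_circleMap_sub_of_lt {ρ : ℝ} {a : ℂ} (h : ‖a‖ < ρ) :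
    ∫ θ in (0)..(2 * π), (‖circleMap 0 ρ θ - a‖ ^ 2)⁻¹ = 2 * π / (ρ ^ 2 - ‖a‖ ^ 2) := by
  have hρ : 0 ≤ ρ := (norm_nonneg a).trans h.le
  have hd : ρ ^ 2 - ‖a‖ ^ 2 ≠ 0 := by
    have := norm_nonneg a
    nlinarith
  have h1 := InnerProductSpace.HarmonicOnNhd.circleAverage_poissonKernel_smul
    (f := fun _ => (1 : ℝ)) (c := 0) (R := ρ) (w := a)
    (fun x _ => InnerProductSpace.harmonicAt_const _) (by simpa using h)
  simp only [Real.circleAverage, Pi.smul_apply', poissonKernel, sub_zero, norm_circleMap_zero,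
    abs_of_nonneg hρ, smul_eq_mul, mul_one, div_eq_mul_inv,
    intervalIntegral.integral_const_mul] at h1
  field_simp at h1 ⊢
  linarith

theorem integral_inv_sq_norm_circleMap_sub {ρ : ℝ} (hρ : 0 ≤ ρ) {a : ℂ} (h : ρ ≠ ‖a‖) :
    ∫ θ in (0)..(2 * π), (‖circleMap 0 ρ θ - a‖ ^ 2)⁻¹ = 2 * π / |ρ ^ 2 - ‖a‖ ^ 2| := by
  rcases h.lt_or_gt with h | h
  · have ha : circleMap 0 ‖a‖ a.arg = a := by simp [circleMap]
    have hn : ‖circleMap 0 ρ a.arg‖ = ρ := by simp [abs_of_nonneg hρ]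
    have hs (θ : ℝ) : ‖circleMap 0 ρ θ - a‖ = ‖circleMap 0 ‖a‖ θ - circleMap 0 ρ a.arg‖ := by
      conv_lhs => rw [← ha, norm_circleMap_sub_comm]
    simp_rw [hs]
    rw [integral_inv_sq_norm_circleMap_sub_of_lt (by rwa [hn]), hn, abs_sub_comm, abs_of_nonneg]
    nlinarith
  · rw [integral_inv_sq_norm_circleMap_sub_of_lt h, abs_of_nonneg]
    nlinarith [norm_nonneg a]

theorem lintegral_enorm_inv_circleMap_sub_sq {ρ : ℝ} (hρ : 0 ≤ ρ) {a : ℂ} (h : ρ ≠ ‖a‖) :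
    ∫⁻ θ in Set.Ioo (-π) π, ‖(circleMap 0 ρ θ - a)⁻¹‖ₑ ^ 2 =
      ENNReal.ofReal (2 * π / |ρ ^ 2 - ‖a‖ ^ 2|) := by
  have hne (θ : ℝ) : circleMap 0 ρ θ - a ≠ 0 := fun h0 => h <| by
    rw [← sub_eq_zero.1 h0, norm_circleMap_zero, abs_of_nonneg hρ]
  have hc : Continuous fun θ : ℝ => (‖circleMap 0 ρ θ - a‖ ^ 2)⁻¹ :=
    Continuous.inv₀ (by fun_prop) fun θ => pow_ne_zero 2 (norm_ne_zero_iff.2 (hne θ))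
  have hp : Function.Periodic (fun θ : ℝ => (‖circleMap 0 ρ θ - a‖ ^ 2)⁻¹) (2 * π) := fun θ => by
    simp only [periodic_circleMap 0 ρ θ]
  have he (θ : ℝ) : ‖(circleMap 0 ρ θ - a)⁻¹‖ₑ ^ 2 =
      ENNReal.ofReal ((‖circleMap 0 ρ θ - a‖ ^ 2)⁻¹) := by
    rw [← ofReal_norm, ← ENNReal.ofReal_pow (norm_nonneg _), norm_inv, inv_pow]
  simp_rw [he]
  rw [← integral_inv_sq_norm_circleMap_sub hρ h,
    ← ofReal_integral_eq_lintegral_ofReal ((hc.integrableOn_Icc (a := -π) (b := π)).mono_set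
      Set.Ioo_subset_Icc_self) (ae_of_all _ fun θ => by positivity),
    ← integral_Ioc_eq_integral_Ioo, ← intervalIntegral.integral_of_le (by linarith [pi_pos])]
  have := hp.intervalIntegral_add_eq (-π) 0
  rw [show -π + 2 * π = π by ring, zero_add] at this
  rw [this]

theorem setLIntegral_ball_eq_polar {g : ℂ → ℝ≥0∞} (hg : Measurable g) (r : ℝ) :
    ∫⁻ z in ball (0 : ℂ) r, g z =
      ∫⁻ ρ in Set.Ioo 0 r, ENNReal.ofReal ρ * ∫⁻ θ in Set.Ioo (-π) π, g (circleMap 0 ρ θ) := by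
  have hm : Measurable fun p : ℝ × ℝ => circleMap 0 p.1 p.2 := by
    simp only [circleMap]
    fun_prop
  have hB : Measurable fun p : ℝ × ℝ => ENNReal.ofReal p.1 * g (circleMap 0 p.1 p.2) := by
    fun_prop
  rw [← lintegral_indicator measurableSet_ball, ← Complex.lintegral_comp_polarCoord_symm,
    ← lintegral_indicator polarCoord.open_target.measurableSet]
  calc _ = ∫⁻ p in Set.Ioo 0 r ×ˢ Set.Ioo (-π) π,
        ENNReal.ofReal p.1 * g (circleMap 0 p.1 p.2) := by
        rw [← lintegral_indicator (measurableSet_Ioo.prod measurableSet_Ioo)]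
        refine lintegral_congr fun p => ?_
        have hs : Complex.polarCoord.symm p = circleMap 0 p.1 p.2 := by
          simp [circleMap, Complex.exp_mul_I]
        simp only [Set.indicator_apply, polarCoord_target, Set.mem_prod, Set.mem_Ioi, Set.mem_Ioo,
          hs, smul_eq_mul]
        by_cases h0 : 0 < p.1
        · by_cases h1 : p.1 < r <;> simp [h0, h1, abs_of_pos h0]
        · simp [h0]
    _ = _ := by
        rw [Measure.volume_eq_prod, ← Measure.prod_restrict, lintegral_prod _ hB.aemeasurable]
        have hgρ (ρ : ℝ) : Measurable fun θ => g (circleMap 0 ρ θ) :=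
          hg.comp (measurable_circleMap 0 ρ)
        refine lintegral_congr fun ρ => ?_
        dsimp only
        exact lintegral_const_mul _ (hgρ ρ)

theorem sq_lintegral_le_lintegral_inv_mul {α : Type*} [MeasurableSpace α] {ν : Measure α}
    {f w : α → ℝ≥0∞} (hf : AEMeasurable f ν) (hw : AEMeasurable w ν)
    (h0 : ∀ᵐ x ∂ν, w x ≠ 0) (htop : ∀ᵐ x ∂ν, w x ≠ ⊤) :
    (∫⁻ x, f x ∂ν) ^ 2 ≤ (∫⁻ x, (w x)⁻¹ ∂ν) * ∫⁻ x, w x * f x ^ 2 ∂ν := by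
  have h := ENNReal.lintegral_mul_le_Lp_mul_Lq ν Real.HolderConjugate.two_two
    (f := fun x => (w x)⁻¹ ^ (1 / 2 : ℝ)) (g := fun x => w x ^ (1 / 2 : ℝ) * f x)
    (hw.inv.pow_const _) ((hw.pow_const _).mul hf)
  have hl : ∫⁻ x, f x ∂ν =
      ∫⁻ x, ((fun x => (w x)⁻¹ ^ (1 / 2 : ℝ)) * fun x => w x ^ (1 / 2 : ℝ) * f x) x ∂ν := by
    refine lintegral_congr_ae ?_
    filter_upwards [h0, htop] with x hx hx'
    rw [Pi.mul_apply, ← mul_assoc, ← ENNReal.mul_rpow_of_nonneg _ _ (by norm_num),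
      ENNReal.inv_mul_cancel hx hx', ENNReal.one_rpow, one_mul]
  have hsq (y : ℝ≥0∞) : (y ^ (1 / 2 : ℝ)) ^ 2 = y := by
    rw [← ENNReal.rpow_natCast, ← ENNReal.rpow_mul]
    norm_num
  rw [← hl] at h
  refine (pow_le_pow_left' h 2).trans_eq ?_
  rw [mul_pow, hsq, hsq]
  simp only [ENNReal.rpow_two, mul_pow, hsq]

/-- The weight `√|ρ² - s²|`; its inverse is, up to a constant, the `L²` mean of `1 / |z - u|` over
the circle `|z| = ρ` when `|u| = s`. -/
noncomputable def annulusWeight (ρ s : ℝ) : ℝ≥0∞ := ENNReal.ofReal √|ρ ^ 2 - s ^ 2|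

theorem measurable_annulusWeight : Measurable fun p : ℝ × ℝ => annulusWeight p.1 p.2 := by
  unfold annulusWeight
  fun_prop

theorem annulusWeight_eq_zero_iff {ρ s : ℝ} : annulusWeight ρ s = 0 ↔ ρ = s ∨ ρ = -s := by
  rw [annulusWeight, ENNReal.ofReal_eq_zero, Real.sqrt_le_iff]
  simp [sub_eq_zero, sq_eq_sq_iff_eq_or_eq_neg]

theorem annulusWeight_inv_sq {ρ s : ℝ} (h : annulusWeight ρ s ≠ 0) :
    ENNReal.ofReal (1 / |ρ ^ 2 - s ^ 2|) = (annulusWeight ρ s)⁻¹ ^ 2 := by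
  have h' : 0 < √|ρ ^ 2 - s ^ 2| := by simpa [annulusWeight] using h
  rw [annulusWeight, ← ENNReal.ofReal_inv_of_pos h', ← ENNReal.ofReal_pow (by positivity), inv_pow,
    Real.sq_sqrt (abs_nonneg _), one_div]

/-- Weighted Cauchy-Schwarz in polar coordinates. -/
theorem setLIntegral_ball_sq_lintegral_le {ν : Measure ℝ} [SFinite ν] [NullSingletonClass ν]
    {f : ℂ → ℝ → ℝ≥0∞} (hf : Measurable (Function.uncurry f)) (r : ℝ) :
    ∫⁻ z in ball (0 : ℂ) r, (∫⁻ s, f z s ∂ν) ^ 2 ≤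
      ∫⁻ p, ENNReal.ofReal p.1 * (∫⁻ s, (annulusWeight p.1 s)⁻¹ ∂ν) * (annulusWeight p.1 p.2 *
        ∫⁻ θ in Set.Ioo (-π) π, f (circleMap 0 p.1 θ) p.2 ^ 2)
        ∂((volume.restrict (Set.Ioo 0 r)).prod ν) := by
  have hm : Measurable fun p : ℝ × ℝ => circleMap 0 p.1 p.2 := by
    simp only [circleMap]
    fun_prop
  have hf2 : Measurable fun q : (ℝ × ℝ) × ℝ => f (circleMap 0 q.1.1 q.2) q.1.2 ^ 2 := by
    have : Measurable fun q : (ℝ × ℝ) × ℝ => (circleMap 0 q.1.1 q.2, q.1.2) :=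
      (hm.comp (by fun_prop : Measurable fun q : (ℝ × ℝ) × ℝ => (q.1.1, q.2))).prodMk (by fun_prop)
    exact (hf.comp this).pow_const 2
  have hH : Measurable fun ρ => ∫⁻ s, (annulusWeight ρ s)⁻¹ ∂ν :=
    measurable_annulusWeight.inv.lintegral_prod_right'
  have hF : Measurable fun z => (∫⁻ s, f z s ∂ν) ^ 2 := hf.lintegral_prod_right'.pow_const 2
  rw [setLIntegral_ball_eq_polar hF, lintegral_prod _ (by
    refine Measurable.aemeasurable ?_
    exact ((by fun_prop : Measurable fun p : ℝ × ℝ => ENNReal.ofReal p.1).mul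
      (hH.comp measurable_fst)).mul (measurable_annulusWeight.mul hf2.lintegral_prod_right'))]
  refine lintegral_mono fun ρ => ?_
  have hwρ : Measurable (annulusWeight ρ) := measurable_annulusWeight.of_uncurry_left
  have h0 : ∀ᵐ s ∂ν, annulusWeight ρ s ≠ 0 := by
    have h1 : ∀ᵐ s ∂ν, s ≠ ρ := by simp [ae_iff]
    have h2 : ∀ᵐ s ∂ν, s ≠ -ρ := by simp [ae_iff]
    filter_upwards [h1, h2] with s h1 h2 h
    rcases annulusWeight_eq_zero_iff.1 h with h | h
    · exact h1 h.symm
    · exact h2 (by linarith)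
  have hwθ : Measurable fun q : ℝ × ℝ => annulusWeight ρ q.2 * f (circleMap 0 ρ q.1) q.2 ^ 2 :=
    (hwρ.comp measurable_snd).mul
      (hf2.comp (by fun_prop : Measurable fun q : ℝ × ℝ => ((ρ, q.2), q.1)))
  have hfs (s : ℝ) : Measurable fun θ => f (circleMap 0 ρ θ) s ^ 2 :=
    hf2.comp (by fun_prop : Measurable fun θ : ℝ => ((ρ, s), θ))
  have hθ : Measurable fun s => annulusWeight ρ s *
      ∫⁻ θ in Set.Ioo (-π) π, f (circleMap 0 ρ θ) s ^ 2 :=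
    hwρ.mul (hf2.lintegral_prod_right'.comp (by fun_prop : Measurable fun s : ℝ => (ρ, s)))
  dsimp only
  rw [lintegral_const_mul _ hθ, mul_assoc]
  gcongr
  calc ∫⁻ θ in Set.Ioo (-π) π, (∫⁻ s, f (circleMap 0 ρ θ) s ∂ν) ^ 2
      ≤ ∫⁻ θ in Set.Ioo (-π) π, (∫⁻ s, (annulusWeight ρ s)⁻¹ ∂ν) *
          ∫⁻ s, annulusWeight ρ s * f (circleMap 0 ρ θ) s ^ 2 ∂ν :=
        lintegral_mono fun θ => sq_lintegral_le_lintegral_inv_mul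
          (hf.of_uncurry_left).aemeasurable hwρ.aemeasurable h0
          (ae_of_all _ fun s => ENNReal.ofReal_ne_top)
    _ = _ := by
        rw [lintegral_const_mul _ hwθ.lintegral_prod_right', lintegral_lintegral_swap
          hwθ.aemeasurable]
        simp_rw [lintegral_const_mul _ (hfs _)]

theorem setLIntegral_Ioi_zero_comp_mul_left {g : ℝ → ℝ≥0∞} (hg : Measurable g) {ρ : ℝ}
    (hρ : 0 < ρ) :
    ∫⁻ s in Set.Ioi 0, g s = ENNReal.ofReal ρ * ∫⁻ s in Set.Ioi 0, g (ρ * s) := by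
  have hg' : Measurable ((Set.Ioi (0 : ℝ)).indicator g) := hg.indicator measurableSet_Ioi
  rw [← lintegral_indicator measurableSet_Ioi, ← lintegral_indicator measurableSet_Ioi]
  conv_lhs => rw [← Real.smul_map_volume_mul_left hρ.ne', abs_of_pos hρ]
  rw [lintegral_smul_measure, lintegral_map hg' (by fun_prop), smul_eq_mul]
  congr 1
  refine lintegral_congr fun s => ?_
  simp [Set.indicator_apply, hρ]

theorem integrableOn_rpow_div_sqrt_abs_one_sub_sq {β : ℝ} (h1 : -1 < β) (h0 : β < 0) :
    IntegrableOn (fun s : ℝ => s ^ β / √|1 - s ^ 2|) (Set.Ioi 0) := by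
  have hm (s : Set ℝ) : AEStronglyMeasurable (fun s : ℝ => s ^ β / √|1 - s ^ 2|)
      (volume.restrict s) := by
    refine Measurable.aestronglyMeasurable ?_
    fun_prop
  have hunion : Set.Ioi (0 : ℝ) = Set.Ioc 0 (1 / 2) ∪ (Set.Ioc (1 / 2) 2 ∪ Set.Ioi 2) := by
    rw [Set.Ioc_union_Ioi_eq_Ioi (by norm_num), Set.Ioc_union_Ioi_eq_Ioi (by norm_num)]
  rw [hunion]
  refine IntegrableOn.union ?_ (IntegrableOn.union ?_ ?_)
  · have hi : IntegrableOn (fun s : ℝ => 2 * s ^ β) (Set.Ioc 0 (1 / 2)) :=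
      ((intervalIntegral.intervalIntegrable_rpow' h1).1).const_mul 2
    refine hi.mono' (hm _) ((ae_restrict_mem measurableSet_Ioc).mono fun s hs => ?_)
    have hs0 := hs.1
    have hs1 := hs.2
    have hp : 0 < s ^ β := Real.rpow_pos_of_pos hs0 _
    have hsq : 1 / 2 ≤ √|1 - s ^ 2| := by
      rw [abs_of_nonneg (by nlinarith)]
      exact Real.le_sqrt_of_sq_le (by nlinarith)
    rw [Real.norm_of_nonneg (by positivity), div_le_iff₀ (by linarith)]
    nlinarith
  · have hr1 : IntegrableOn (fun s : ℝ => (1 - s) ^ (-(1 / 2) : ℝ)) (Set.Ioc (1 / 2) 2) :=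
      (((intervalIntegral.intervalIntegrable_rpow' (a := 1 / 2) (b := -1)
        (by norm_num : (-1 : ℝ) < -(1 / 2))).comp_sub_left 1).mono_set (by norm_num)).1
    have hr2 : IntegrableOn (fun s : ℝ => (s - 1) ^ (-(1 / 2) : ℝ)) (Set.Ioc (1 / 2) 2) :=
      (((intervalIntegral.intervalIntegrable_rpow' (a := -(1 / 2)) (b := 1)
        (by norm_num : (-1 : ℝ) < -(1 / 2))).comp_sub_right 1).mono_set (by norm_num)).1
    have hi := (hr1.norm.add hr2.norm).const_mul (2 : ℝ)
    refine hi.mono' (hm _) ((ae_restrict_mem measurableSet_Ioc).mono fun s hs => ?_)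
    have hs0 : 0 < s := by linarith [hs.1]
    have hβ : s ^ β ≤ 2 := by
      calc s ^ β ≤ (1 / 2 : ℝ) ^ β := Real.rpow_le_rpow_of_nonpos (by norm_num) hs.1.le h0.le
        _ ≤ (1 / 2 : ℝ) ^ (-1 : ℝ) :=
          Real.rpow_le_rpow_of_exponent_ge (by norm_num) (by norm_num) h1.le
        _ = 2 := by norm_num [Real.rpow_neg_one]
    have key : (√|1 - s|)⁻¹ ≤ ‖(1 - s) ^ (-(1 / 2) : ℝ)‖ + ‖(s - 1) ^ (-(1 / 2) : ℝ)‖ := by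
      rcases le_total s 1 with h | h
      · refine le_add_of_le_of_nonneg (le_of_eq ?_) (norm_nonneg _)
        rw [abs_of_nonneg (by linarith), Real.rpow_neg (by linarith), ← Real.sqrt_eq_rpow,
          Real.norm_of_nonneg (by positivity)]
      · refine le_add_of_nonneg_of_le (norm_nonneg _) (le_of_eq ?_)
        rw [abs_sub_comm, abs_of_nonneg (by linarith), Real.rpow_neg (by linarith),
          ← Real.sqrt_eq_rpow, Real.norm_of_nonneg (by positivity)]
    have hsq : (√|1 - s ^ 2|)⁻¹ ≤ (√|1 - s|)⁻¹ := by
      rcases eq_or_ne s 1 with rfl | h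
      · simp
      · have : 0 < |1 - s| := abs_pos.2 (sub_ne_zero.2 h.symm)
        refine inv_anti₀ (Real.sqrt_pos.2 this) (Real.sqrt_le_sqrt ?_)
        rw [show 1 - s ^ 2 = (1 - s) * (1 + s) by ring, abs_mul, abs_of_pos (by linarith : 0 < 1 + s)]
        nlinarith
    have hp : 0 ≤ s ^ β := Real.rpow_nonneg hs0.le _
    rw [Real.norm_of_nonneg (by positivity), div_eq_mul_inv]
    exact mul_le_mul hβ (hsq.trans key) (by positivity) (by norm_num)
  · have hi : IntegrableOn (fun s : ℝ => 2 * s ^ (β - 1)) (Set.Ioi 2) :=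
      (integrableOn_Ioi_rpow_of_lt (by linarith) (by norm_num)).const_mul 2
    refine hi.mono' (hm _) ((ae_restrict_mem measurableSet_Ioi).mono fun s hs => ?_)
    have hs2 : 2 < s := hs
    have hp : 0 < s ^ β := Real.rpow_pos_of_pos (by linarith) _
    have hsq : s / 2 ≤ √|1 - s ^ 2| := by
      rw [abs_sub_comm, abs_of_nonneg (by nlinarith)]
      exact Real.le_sqrt_of_sq_le (by nlinarith)
    rw [Real.norm_of_nonneg (by positivity), Real.rpow_sub_one (by linarith),
      div_le_iff₀ (by linarith)]
    calc s ^ β = 2 * (s ^ β / s) * (s / 2) := by field_simp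
      _ ≤ _ := by gcongr

theorem annulusWeight_mul_left {ρ : ℝ} (hρ : 0 < ρ) (s : ℝ) :
    annulusWeight ρ (ρ * s) = ENNReal.ofReal ρ * annulusWeight 1 s := by
  rw [annulusWeight, annulusWeight, ← ENNReal.ofReal_mul hρ.le,
    show ρ ^ 2 - (ρ * s) ^ 2 = ρ ^ 2 * (1 ^ 2 - s ^ 2) by ring, abs_mul,
    abs_of_nonneg (sq_nonneg ρ), Real.sqrt_mul (sq_nonneg ρ), Real.sqrt_sq hρ.le]

theorem measurable_inv_annulusWeight_left (ρ : ℝ) : Measurable fun s => (annulusWeight ρ s)⁻¹ :=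
  (measurable_annulusWeight.of_uncurry_left (x := ρ)).inv

/-- The radial vorticity distribution `(2 - 1/μ)·s^{1-1/μ} ds` on `(0,∞)`. -/
noncomputable def kadenRadial (μ : ℝ) : Measure ℝ :=
  ((volume : Measure ℝ).restrict (Set.Ioi 0)).withDensity
    (fun s => ENNReal.ofReal ((2 - 1 / μ) * s ^ (1 - 1 / μ)))

instance (μ : ℝ) : SFinite (kadenRadial μ) := by
  unfold kadenRadial
  infer_instance

instance (μ : ℝ) : NullSingletonClass (kadenRadial μ) :=
  ⟨fun x => withDensity_absolutelyContinuous _ _ (measure_singleton x)⟩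

theorem exists_lintegral_inv_annulusWeight_eq {μ : ℝ} (hμ : μ ∈ Set.Ioo (1 / 2 : ℝ) 1) :
    ∃ C : ℝ≥0∞, C ≠ ⊤ ∧ ∀ ρ : ℝ, 0 < ρ →
      ∫⁻ s, (annulusWeight ρ s)⁻¹ ∂kadenRadial μ = C * ENNReal.ofReal (ρ ^ (1 - 1 / μ)) := by
  have hμ0 : 0 < μ := by linarith [hμ.1]
  have hβ1 : -1 < 1 - 1 / μ := by
    have : 1 / μ < 2 := by rw [div_lt_iff₀ hμ0]; linarith [hμ.1]
    linarith
  have hβ0 : 1 - 1 / μ < 0 := by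
    have : 1 < 1 / μ := by rw [lt_div_iff₀ hμ0]; linarith [hμ.2]
    linarith
  have ha : 0 < 2 - 1 / μ := by linarith
  unfold kadenRadial
  generalize 1 - 1 / μ = β at *
  generalize 2 - 1 / μ = a at *
  have hw := measurable_inv_annulusWeight_left
  have hd : Measurable fun s : ℝ => ENNReal.ofReal (a * s ^ β) := by fun_prop
  refine ⟨∫⁻ s in Set.Ioi 0, ENNReal.ofReal (a * s ^ β) * (annulusWeight 1 s)⁻¹, ?_, ?_⟩
  · have hint := ((integrableOn_rpow_div_sqrt_abs_one_sub_sq hβ1 hβ0).const_mul a).lintegral_lt_top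
    refine (lt_of_le_of_lt (lintegral_mono_ae ?_) hint).ne
    have h1 : ∀ᵐ s : ℝ ∂volume.restrict (Set.Ioi 0), s ≠ 1 :=
      ae_restrict_of_ae (by simp [ae_iff])
    filter_upwards [h1, ae_restrict_mem measurableSet_Ioi] with s hs hs0
    have hs0 : 0 < s := hs0
    have hpos : 0 < √|1 ^ 2 - s ^ 2| := by
      refine Real.sqrt_pos.2 (abs_pos.2 fun h => hs ?_)
      nlinarith
    rw [annulusWeight, ← ENNReal.ofReal_inv_of_pos hpos, ← ENNReal.ofReal_mul (by positivity),
      one_pow, mul_assoc, div_eq_mul_inv]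
  · intro ρ hρ
    have hρ0 : ENNReal.ofReal ρ ≠ 0 := by simpa using hρ
    have hg (ρ : ℝ) : Measurable fun s : ℝ => ENNReal.ofReal (a * s ^ β) * (annulusWeight ρ s)⁻¹ :=
      hd.mul (hw ρ)
    have hgρ : Measurable fun s : ℝ =>
        ENNReal.ofReal (a * (ρ * s) ^ β) * (annulusWeight ρ (ρ * s))⁻¹ :=
      (hg ρ).comp (measurable_const_mul ρ)
    rw [lintegral_withDensity_eq_lintegral_mul _ hd (hw ρ)]
    simp only [Pi.mul_apply]
    rw [setLIntegral_Ioi_zero_comp_mul_left (hg ρ) hρ, ← lintegral_const_mul _ hgρ,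
      ← lintegral_mul_const _ (hg 1)]
    refine lintegral_congr_ae ((ae_restrict_mem measurableSet_Ioi).mono fun s hs => ?_)
    have hs : 0 < s := hs
    dsimp only
    rw [annulusWeight_mul_left hρ, ENNReal.mul_inv (.inl hρ0) (.inl ENNReal.ofReal_ne_top),
      Real.mul_rpow hρ.le hs.le, show a * (ρ ^ β * s ^ β) = a * s ^ β * ρ ^ β by ring,
      ENNReal.ofReal_mul (by positivity)]
    calc _ = ENNReal.ofReal ρ * (ENNReal.ofReal ρ)⁻¹ * (ENNReal.ofReal (a * s ^ β) *
          (annulusWeight 1 s)⁻¹ * ENNReal.ofReal (ρ ^ β)) := by ring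
      _ = _ := by rw [ENNReal.mul_inv_cancel hρ0 ENNReal.ofReal_ne_top, one_mul]

theorem lintegral_inv_annulusWeight_ne_top {μ : ℝ} (hμ : μ ∈ Set.Ioo (1 / 2 : ℝ) 1) (r : ℝ) :
    ∫⁻ p, ENNReal.ofReal p.1 * (∫⁻ s, (annulusWeight p.1 s)⁻¹ ∂kadenRadial μ) *
      (annulusWeight p.1 p.2)⁻¹ ∂((volume.restrict (Set.Ioo 0 r)).prod (kadenRadial μ)) ≠ ⊤ := by
  obtain ⟨C, hC, hCρ⟩ := exists_lintegral_inv_annulusWeight_eq hμ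
  have hμ0 : 0 < μ := by linarith [hμ.1]
  have hβ1 : -1 < 1 - 1 / μ := by
    have : 1 / μ < 2 := by rw [div_lt_iff₀ hμ0]; linarith [hμ.1]
    linarith
  have hw : Measurable fun p : ℝ × ℝ => (annulusWeight p.1 p.2)⁻¹ := measurable_annulusWeight.inv
  have hH : Measurable fun ρ => ∫⁻ s, (annulusWeight ρ s)⁻¹ ∂kadenRadial μ :=
    hw.lintegral_prod_right'
  have hρm : Measurable fun p : ℝ × ℝ => ENNReal.ofReal p.1 := by fun_prop
  have hm : Measurable fun p : ℝ × ℝ => ENNReal.ofReal p.1 *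
      (∫⁻ s, (annulusWeight p.1 s)⁻¹ ∂kadenRadial μ) * (annulusWeight p.1 p.2)⁻¹ :=
    (hρm.mul (hH.comp measurable_fst)).mul hw
  rw [lintegral_prod _ hm.aemeasurable]
  have hint : IntegrableOn (fun ρ : ℝ => ρ ^ (1 + 2 * (1 - 1 / μ))) (Set.Ioo 0 r) :=
    (intervalIntegral.intervalIntegrable_rpow' (a := 0) (b := r) (by linarith)).1.mono_set
      Set.Ioo_subset_Ioc_self
  refine (lt_of_le_of_lt (b := ∫⁻ ρ in Set.Ioo 0 r, C ^ 2 *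
    ENNReal.ofReal (ρ ^ (1 + 2 * (1 - 1 / μ)))) ?_ ?_).ne
  · refine lintegral_mono_ae ((ae_restrict_mem measurableSet_Ioo).mono fun ρ hρ => ?_)
    dsimp only
    have hp : 0 ≤ ρ ^ (1 - 1 / μ) := Real.rpow_nonneg hρ.1.le _
    rw [lintegral_const_mul _ (measurable_inv_annulusWeight_left ρ), hCρ ρ hρ.1,
      Real.rpow_add hρ.1, Real.rpow_one, mul_comm 2, Real.rpow_mul hρ.1.le, Real.rpow_two,
      ENNReal.ofReal_mul hρ.1.le, ENNReal.ofReal_pow hp]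
    exact le_of_eq (by ring)
  · rw [lintegral_const_mul _ (by fun_prop)]
    exact ENNReal.mul_lt_top (ENNReal.pow_lt_top hC.lt_top) hint.lintegral_lt_top

theorem tendsto_lintegral_enorm_sq_of_sub {α ι : Type*} [MeasurableSpace α] {ν : Measure α}
    {l : Filter ι} {f : ι → α → ℂ} {g : α → ℂ} (hf : ∀ i, AEStronglyMeasurable (f i) ν)
    (hg : AEStronglyMeasurable g ν)
    (h : Tendsto (fun i => ∫⁻ x, ‖f i x - g x‖ₑ ^ 2 ∂ν) l (𝓝 0)) :
    Tendsto (fun i => ∫⁻ x, ‖f i x‖ₑ ^ 2 ∂ν) l (𝓝 (∫⁻ x, ‖g x‖ₑ ^ 2 ∂ν)) := by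
  have hN (F : α → ℂ) : ∫⁻ x, ‖F x‖ₑ ^ 2 ∂ν = eLpNorm F 2 ν ^ 2 := by
    have := eLpNorm_nnreal_pow_eq_lintegral (f := F) (μ := ν) (p := 2) two_ne_zero
    simpa using this.symm
  have hd : Tendsto (fun i => eLpNorm (f i - g) 2 ν) l (𝓝 0) := by
    have h' := h.ennrpow_const (1 / 2)
    rw [ENNReal.zero_rpow_of_pos (by norm_num)] at h'
    refine h'.congr fun i => ?_
    rw [show (fun x => ‖f i x - g x‖ₑ ^ 2) = fun x => ‖(f i - g) x‖ₑ ^ 2 from rfl, hN,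
      ← ENNReal.rpow_natCast, ← ENNReal.rpow_mul]
    norm_num
  have hup (i : ι) : eLpNorm (f i) 2 ν ≤ eLpNorm g 2 ν + eLpNorm (f i - g) 2 ν := by
    calc _ = eLpNorm (g + (f i - g)) 2 ν := by rw [add_sub_cancel]
      _ ≤ _ := eLpNorm_add_le hg ((hf i).sub hg) (by norm_num)
  have hlow (i : ι) : eLpNorm g 2 ν - eLpNorm (f i - g) 2 ν ≤ eLpNorm (f i) 2 ν := by
    refine tsub_le_iff_right.2 ?_
    calc _ = eLpNorm (f i - (f i - g)) 2 ν := by rw [sub_sub_cancel]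
      _ ≤ _ := eLpNorm_sub_le (hf i) ((hf i).sub hg) (by norm_num)
  have hl : Tendsto (fun i => eLpNorm (f i) 2 ν) l (𝓝 (eLpNorm g 2 ν)) := by
    refine tendsto_of_tendsto_of_tendsto_of_le_of_le ?_ ?_ hlow hup
    · simpa using ENNReal.Tendsto.sub (tendsto_const_nhds (x := eLpNorm g 2 ν)) hd
        (Or.inr ENNReal.zero_ne_top)
    · simpa using (tendsto_const_nhds (x := eLpNorm g 2 ν)).add hd
  simp_rw [hN]
  exact ((ENNReal.continuous_pow 2).tendsto _).comp hl

theorem norm_kadenCurve (μ t s : ℝ) : ‖kadenCurve μ t s‖ = |s| := by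
  rw [kadenCurve, norm_mul, mul_comm Complex.I, Complex.norm_exp_ofReal_mul_I, mul_one,
    Complex.norm_real, Real.norm_eq_abs]

theorem measurable_kadenCurve (μ t : ℝ) : Measurable (kadenCurve μ t) := by
  unfold kadenCurve
  fun_prop

theorem continuous_kadenCurve_time (μ s : ℝ) : Continuous fun t => kadenCurve μ t s := by
  unfold kadenCurve
  fun_prop

theorem biotSavart_kadenMeasure (μ t : ℝ) (z : ℂ) :
    biotSavart (kadenMeasure μ t) z = (2 * π)⁻¹ •
      ∫ s, Complex.I * star ((z - kadenCurve μ t s)⁻¹) ∂kadenRadial μ := by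
  have hker (w : ℂ) : Complex.I * w / (((‖w‖ : ℝ) : ℂ) ^ 2) = Complex.I * star (w⁻¹) := by
    rw [Complex.star_def, Complex.inv_def, map_mul, Complex.conj_conj, Complex.conj_ofReal,
      Complex.normSq_eq_norm_sq]
    push_cast
    rw [div_eq_mul_inv, mul_assoc]
  have hm : Measurable fun u : ℂ => Complex.I * star ((z - u)⁻¹) :=
    (continuous_star.measurable.comp (by fun_prop)).const_mul _
  unfold biotSavart kadenMeasure
  simp_rw [hker]
  rw [integral_map (measurable_kadenCurve μ t).aemeasurable hm.aestronglyMeasurable]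
  rfl

theorem measurable_inv_sub_kadenCurve (μ t : ℝ) :
    Measurable fun q : ℂ × ℝ => (q.1 - kadenCurve μ t q.2)⁻¹ :=
  (measurable_fst.sub ((measurable_kadenCurve μ t).comp measurable_snd)).inv

theorem stronglyMeasurable_biotSavart_kadenMeasure (μ t : ℝ) :
    StronglyMeasurable fun z => biotSavart (kadenMeasure μ t) z := by
  simp_rw [biotSavart_kadenMeasure]
  have hm : Measurable fun q : ℂ × ℝ => Complex.I * star ((q.1 - kadenCurve μ t q.2)⁻¹) :=
    (continuous_star.measurable.comp (measurable_inv_sub_kadenCurve μ t)).const_mul _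
  have hint := hm.stronglyMeasurable.integral_prod_right' (ν := kadenRadial μ)
  exact hint.const_smul ((2 * π)⁻¹)

theorem enorm_biotSavart_kadenMeasure_sub_le {μ t t' : ℝ} {z : ℂ}
    (h : ∫⁻ s, ‖(z - kadenCurve μ t s)⁻¹‖ₑ ∂kadenRadial μ ≠ ⊤)
    (h' : ∫⁻ s, ‖(z - kadenCurve μ t' s)⁻¹‖ₑ ∂kadenRadial μ ≠ ⊤) :
    ‖biotSavart (kadenMeasure μ t) z - biotSavart (kadenMeasure μ t') z‖ₑ ≤
      ∫⁻ s, ‖(z - kadenCurve μ t s)⁻¹ - (z - kadenCurve μ t' s)⁻¹‖ₑ ∂kadenRadial μ := by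
  have hint {τ : ℝ} (hτ : ∫⁻ s, ‖(z - kadenCurve μ τ s)⁻¹‖ₑ ∂kadenRadial μ ≠ ⊤) :
      Integrable (fun s => Complex.I * star ((z - kadenCurve μ τ s)⁻¹)) (kadenRadial μ) := by
    have hm : Measurable fun s => (z - kadenCurve μ τ s)⁻¹ :=
      ((measurable_kadenCurve μ τ).const_sub z).inv
    refine ⟨((continuous_star.measurable.comp hm).const_mul _).aestronglyMeasurable, ?_⟩
    refine lt_of_le_of_lt (lintegral_mono fun s => ?_) hτ.lt_top
    rw [enorm_le_iff_norm_le, norm_mul, norm_star, Complex.norm_I, one_mul]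
  rw [biotSavart_kadenMeasure, biotSavart_kadenMeasure, ← smul_sub,
    ← integral_sub (hint h) (hint h'), enorm_smul]
  have hpi : ‖(2 * π)⁻¹‖ₑ ≤ 1 := by
    rw [← ofReal_norm, ENNReal.ofReal_le_one, Real.norm_of_nonneg (by positivity)]
    exact inv_le_one_of_one_le₀ (by linarith [Real.pi_gt_three])
  refine (mul_le_of_le_one_left' hpi).trans
    ((enorm_integral_le_lintegral_enorm _).trans (lintegral_mono fun s => ?_))
  rw [← mul_sub, ← star_sub, enorm_le_iff_norm_le, norm_mul, norm_star, Complex.norm_I, one_mul]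

theorem annulusWeight_mul_lintegral_le (μ t : ℝ) {ρ : ℝ} (hρ : 0 ≤ ρ) (s : ℝ) :
    annulusWeight ρ s * ∫⁻ θ in Set.Ioo (-π) π, ‖(circleMap 0 ρ θ - kadenCurve μ t s)⁻¹‖ₑ ^ 2 ≤
      ENNReal.ofReal (2 * π) * (annulusWeight ρ s)⁻¹ := by
  rcases eq_or_ne (annulusWeight ρ s) 0 with h | h
  · simp [h]
  have hne : ρ ≠ ‖kadenCurve μ t s‖ := fun h' => h <| annulusWeight_eq_zero_iff.2 <| by
    rw [norm_kadenCurve] at h'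
    rcases abs_choice s with hs | hs <;> simp [h', hs]
  rw [lintegral_enorm_inv_circleMap_sub_sq hρ hne, norm_kadenCurve, sq_abs, div_eq_mul_one_div,
    ENNReal.ofReal_mul (by positivity), annulusWeight_inv_sq h]
  refine le_of_eq ?_
  calc _ = ENNReal.ofReal (2 * π) * (annulusWeight ρ s * (annulusWeight ρ s)⁻¹) *
        (annulusWeight ρ s)⁻¹ := by ring
    _ = _ := by rw [ENNReal.mul_inv_cancel h ENNReal.ofReal_ne_top, mul_one]

theorem annulusWeight_mul_lintegral_sub_le (μ t t' : ℝ) {ρ : ℝ} (hρ : 0 ≤ ρ) (s : ℝ) :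
    annulusWeight ρ s * ∫⁻ θ in Set.Ioo (-π) π, ‖(circleMap 0 ρ θ - kadenCurve μ t s)⁻¹ -
        (circleMap 0 ρ θ - kadenCurve μ t' s)⁻¹‖ₑ ^ 2 ≤
      8 * ENNReal.ofReal (2 * π) * (annulusWeight ρ s)⁻¹ := by
  have hsq (a b : ℂ) : ‖a - b‖ₑ ^ 2 ≤ 4 * (‖a‖ₑ ^ 2 + ‖b‖ₑ ^ 2) := by
    have h1 : ‖a - b‖ₑ ≤ 2 * max ‖a‖ₑ ‖b‖ₑ := by
      rw [two_mul]
      exact (enorm_sub_le).trans (add_le_add (le_max_left _ _) (le_max_right _ _))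
    calc _ ≤ (2 * max ‖a‖ₑ ‖b‖ₑ) ^ 2 := pow_le_pow_left' h1 2
      _ = 4 * max ‖a‖ₑ ‖b‖ₑ ^ 2 := by ring
      _ ≤ _ := by
        gcongr
        rcases max_choice ‖a‖ₑ ‖b‖ₑ with h | h <;> simp [h]
  have hm (τ : ℝ) : Measurable fun θ => ‖(circleMap 0 ρ θ - kadenCurve μ τ s)⁻¹‖ₑ ^ 2 :=
    (((measurable_circleMap 0 ρ).sub_const _).inv.enorm).pow_const 2
  have hadd : Measurable fun θ => ‖(circleMap 0 ρ θ - kadenCurve μ t s)⁻¹‖ₑ ^ 2 +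
      ‖(circleMap 0 ρ θ - kadenCurve μ t' s)⁻¹‖ₑ ^ 2 := (hm t).add (hm t')
  calc _ ≤ annulusWeight ρ s * ∫⁻ θ in Set.Ioo (-π) π,
        4 * (‖(circleMap 0 ρ θ - kadenCurve μ t s)⁻¹‖ₑ ^ 2 +
          ‖(circleMap 0 ρ θ - kadenCurve μ t' s)⁻¹‖ₑ ^ 2) := by
        gcongr
        exact hsq _ _
    _ = 4 * (annulusWeight ρ s * (∫⁻ θ in Set.Ioo (-π) π,
          ‖(circleMap 0 ρ θ - kadenCurve μ t s)⁻¹‖ₑ ^ 2) +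
        annulusWeight ρ s * ∫⁻ θ in Set.Ioo (-π) π,
          ‖(circleMap 0 ρ θ - kadenCurve μ t' s)⁻¹‖ₑ ^ 2) := by
        rw [lintegral_const_mul _ hadd, lintegral_add_left (hm t)]
        ring
    _ ≤ 4 * (ENNReal.ofReal (2 * π) * (annulusWeight ρ s)⁻¹ +
        ENNReal.ofReal (2 * π) * (annulusWeight ρ s)⁻¹) := by
        gcongr 4 * (?_ + ?_) <;> exact annulusWeight_mul_lintegral_le μ _ hρ s
    _ = _ := by ring

theorem tendsto_lintegral_inv_circleMap_sub_kadenCurve (μ t₀ : ℝ) {ρ s : ℝ} (hρ : 0 ≤ ρ)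
    (h : annulusWeight ρ s ≠ 0) :
    Tendsto (fun t => ∫⁻ θ in Set.Ioo (-π) π, ‖(circleMap 0 ρ θ - kadenCurve μ t s)⁻¹ -
        (circleMap 0 ρ θ - kadenCurve μ t₀ s)⁻¹‖ₑ ^ 2) (𝓝 t₀) (𝓝 0) := by
  have hδ : 0 < |ρ - (|s|)| := abs_pos.2 fun h' => h <| annulusWeight_eq_zero_iff.2 <| by
    rcases abs_choice s with hs | hs <;> simp [sub_eq_zero.1 h', hs]
  have hlow (t θ : ℝ) : |ρ - (|s|)| ≤ ‖circleMap 0 ρ θ - kadenCurve μ t s‖ := by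
    have := abs_norm_sub_norm_le (circleMap 0 ρ θ) (kadenCurve μ t s)
    rwa [norm_circleMap_zero, norm_kadenCurve, abs_of_nonneg hρ] at this
  have hb (t θ : ℝ) : ‖(circleMap 0 ρ θ - kadenCurve μ t s)⁻¹ -
      (circleMap 0 ρ θ - kadenCurve μ t₀ s)⁻¹‖ₑ ≤
      ENNReal.ofReal (‖kadenCurve μ t s - kadenCurve μ t₀ s‖ / (|ρ - (|s|)| * |ρ - (|s|)|)) := by
    have hne (τ : ℝ) : circleMap 0 ρ θ - kadenCurve μ τ s ≠ 0 :=
      norm_pos_iff.1 (hδ.trans_le (hlow τ θ))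
    rw [← ofReal_norm, inv_sub_inv (hne t) (hne t₀), sub_sub_sub_cancel_left, norm_div, norm_mul]
    gcongr <;> exact hlow _ _
  have hc : Tendsto (fun t => ENNReal.ofReal
      (‖kadenCurve μ t s - kadenCurve μ t₀ s‖ / (|ρ - (|s|)| * |ρ - (|s|)|)) ^ 2 *
        volume (Set.Ioo (-π) π)) (𝓝 t₀) (𝓝 0) := by
    have hcont : Continuous fun t => ENNReal.ofReal
        (‖kadenCurve μ t s - kadenCurve μ t₀ s‖ / (|ρ - (|s|)| * |ρ - (|s|)|)) ^ 2 := by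
      refine (ENNReal.continuous_pow 2).comp (ENNReal.continuous_ofReal.comp ?_)
      exact ((continuous_kadenCurve_time μ s).sub continuous_const).norm.div_const _
    have := ENNReal.Tendsto.mul_const (b := volume (Set.Ioo (-π) π)) (hcont.tendsto t₀)
      (Or.inr (by simp))
    simpa using this
  refine tendsto_of_tendsto_of_tendsto_of_le_of_le tendsto_const_nhds hc (fun _ => zero_le)
    fun t => ?_
  calc _ ≤ ∫⁻ θ in Set.Ioo (-π) π, ENNReal.ofReal
        (‖kadenCurve μ t s - kadenCurve μ t₀ s‖ / (|ρ - (|s|)| * |ρ - (|s|)|)) ^ 2 :=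
        lintegral_mono fun θ => pow_le_pow_left' (hb t θ) 2
    _ = _ := setLIntegral_const _ _

theorem ae_fst_mem_Ioo (ν : Measure ℝ) [SFinite ν] (r : ℝ) :
    ∀ᵐ p ∂(volume.restrict (Set.Ioo 0 r)).prod ν, p.1 ∈ Set.Ioo 0 r :=
  Measure.quasiMeasurePreserving_fst.ae (ae_restrict_mem measurableSet_Ioo)

theorem ae_lintegral_inv_sub_kadenCurve_ne_top {μ : ℝ} (hμ : μ ∈ Set.Ioo (1 / 2 : ℝ) 1) (t r : ℝ) :
    ∀ᵐ z ∂volume.restrict (ball (0 : ℂ) r),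
      ∫⁻ s, ‖(z - kadenCurve μ t s)⁻¹‖ₑ ∂kadenRadial μ ≠ ⊤ := by
  have hm : Measurable (Function.uncurry fun (z : ℂ) s => ‖(z - kadenCurve μ t s)⁻¹‖ₑ) :=
    (measurable_inv_sub_kadenCurve μ t).enorm
  have hF : Measurable fun z : ℂ => (∫⁻ s, ‖(z - kadenCurve μ t s)⁻¹‖ₑ ∂kadenRadial μ) ^ 2 :=
    hm.lintegral_prod_right'.pow_const 2
  have hfin : ∫⁻ z in ball (0 : ℂ) r,
      (∫⁻ s, ‖(z - kadenCurve μ t s)⁻¹‖ₑ ∂kadenRadial μ) ^ 2 ≠ ⊤ := by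
    refine ne_top_of_le_ne_top (ENNReal.mul_ne_top (ENNReal.ofReal_ne_top (r := 2 * π))
      (lintegral_inv_annulusWeight_ne_top hμ r)) ((setLIntegral_ball_sq_lintegral_le hm r).trans ?_)
    rw [← lintegral_const_mul' _ _ ENNReal.ofReal_ne_top]
    refine lintegral_mono_ae ((ae_fst_mem_Ioo _ r).mono fun p hp => ?_)
    calc _ ≤ ENNReal.ofReal p.1 * (∫⁻ s, (annulusWeight p.1 s)⁻¹ ∂kadenRadial μ) *
          (ENNReal.ofReal (2 * π) * (annulusWeight p.1 p.2)⁻¹) := by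
          exact mul_le_mul' le_rfl (annulusWeight_mul_lintegral_le μ t hp.1.le p.2)
      _ = _ := by ring
  filter_upwards [ae_lt_top hF hfin] with z hz h
  simp [h] at hz

theorem tendsto_setLIntegral_biotSavart_kadenMeasure_sub {μ : ℝ}
    (hμ : μ ∈ Set.Ioo (1 / 2 : ℝ) 1) (r t₀ : ℝ) :
    Tendsto (fun t => ∫⁻ z in ball (0 : ℂ) r,
      ‖biotSavart (kadenMeasure μ t) z - biotSavart (kadenMeasure μ t₀) z‖ₑ ^ 2) (𝓝 t₀) (𝓝 0) := by
  obtain ⟨C, hC, hCρ⟩ := exists_lintegral_inv_annulusWeight_eq hμ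
  have hm (t : ℝ) : Measurable (Function.uncurry fun (z : ℂ) s =>
      ‖(z - kadenCurve μ t s)⁻¹ - (z - kadenCurve μ t₀ s)⁻¹‖ₑ) :=
    ((measurable_inv_sub_kadenCurve μ t).sub (measurable_inv_sub_kadenCurve μ t₀)).enorm
  have hcm : Measurable fun p : ℝ × ℝ => circleMap 0 p.1 p.2 := by
    simp only [circleMap]
    fun_prop
  let F (t : ℝ) (p : ℝ × ℝ) : ℝ≥0∞ :=
    ENNReal.ofReal p.1 * (∫⁻ s, (annulusWeight p.1 s)⁻¹ ∂kadenRadial μ) * (annulusWeight p.1 p.2 *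
      ∫⁻ θ in Set.Ioo (-π) π, ‖(circleMap 0 p.1 θ - kadenCurve μ t p.2)⁻¹ -
        (circleMap 0 p.1 θ - kadenCurve μ t₀ p.2)⁻¹‖ₑ ^ 2)
  have hFm (t : ℝ) : Measurable (F t) := by
    have hq : Measurable fun q : (ℝ × ℝ) × ℝ => (circleMap 0 q.1.1 q.2, q.1.2) :=
      (hcm.comp (by fun_prop : Measurable fun q : (ℝ × ℝ) × ℝ => (q.1.1, q.2))).prodMk (by fun_prop)
    have hθ : Measurable fun q : (ℝ × ℝ) × ℝ => ‖(circleMap 0 q.1.1 q.2 - kadenCurve μ t q.1.2)⁻¹ -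
        (circleMap 0 q.1.1 q.2 - kadenCurve μ t₀ q.1.2)⁻¹‖ₑ ^ 2 := ((hm t).comp hq).pow_const 2
    have hH : Measurable fun ρ => ∫⁻ s, (annulusWeight ρ s)⁻¹ ∂kadenRadial μ :=
      measurable_annulusWeight.inv.lintegral_prod_right'
    have hρ : Measurable fun p : ℝ × ℝ => ENNReal.ofReal p.1 := by fun_prop
    exact (hρ.mul (hH.comp measurable_fst)).mul
      (measurable_annulusWeight.mul hθ.lintegral_prod_right')
  have hle (t : ℝ) : ∫⁻ z in ball (0 : ℂ) r,
      ‖biotSavart (kadenMeasure μ t) z - biotSavart (kadenMeasure μ t₀) z‖ₑ ^ 2 ≤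
      ∫⁻ p, F t p ∂(volume.restrict (Set.Ioo 0 r)).prod (kadenRadial μ) := by
    refine (lintegral_mono_ae ?_).trans (setLIntegral_ball_sq_lintegral_le (hm t) r)
    filter_upwards [ae_lintegral_inv_sub_kadenCurve_ne_top hμ t r,
      ae_lintegral_inv_sub_kadenCurve_ne_top hμ t₀ r] with z hz hz₀
    exact pow_le_pow_left' (enorm_biotSavart_kadenMeasure_sub_le hz hz₀) 2
  refine tendsto_of_tendsto_of_tendsto_of_le_of_le tendsto_const_nhds ?_ (fun _ => zero_le) hle
  rw [← lintegral_zero (μ := (volume.restrict (Set.Ioo 0 r)).prod (kadenRadial μ))]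
  refine tendsto_lintegral_filter_of_dominated_convergence
    (fun p => 8 * ENNReal.ofReal (2 * π) * (ENNReal.ofReal p.1 *
      (∫⁻ s, (annulusWeight p.1 s)⁻¹ ∂kadenRadial μ) * (annulusWeight p.1 p.2)⁻¹))
    (Eventually.of_forall hFm) (Eventually.of_forall fun t => ?_) ?_ ?_
  · refine (ae_fst_mem_Ioo _ r).mono fun p hp => ?_
    calc F t p ≤ ENNReal.ofReal p.1 * (∫⁻ s, (annulusWeight p.1 s)⁻¹ ∂kadenRadial μ) *
          (8 * ENNReal.ofReal (2 * π) * (annulusWeight p.1 p.2)⁻¹) := by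
          exact mul_le_mul' le_rfl (annulusWeight_mul_lintegral_sub_le μ t t₀ hp.1.le p.2)
      _ = _ := by ring
  · have h8 : 8 * ENNReal.ofReal (2 * π) ≠ ⊤ := ENNReal.mul_ne_top (by simp) ENNReal.ofReal_ne_top
    rw [lintegral_const_mul' _ _ h8]
    exact ENNReal.mul_ne_top h8 (lintegral_inv_annulusWeight_ne_top hμ r)
  · refine (ae_fst_mem_Ioo _ r).mono fun p hp => ?_
    rcases eq_or_ne (annulusWeight p.1 p.2) 0 with h | h
    · simp [F, h]
    have hfin : ENNReal.ofReal p.1 * (∫⁻ s, (annulusWeight p.1 s)⁻¹ ∂kadenRadial μ) ≠ ⊤ := by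
      rw [hCρ _ hp.1]
      exact ENNReal.mul_ne_top ENNReal.ofReal_ne_top (ENNReal.mul_ne_top hC ENNReal.ofReal_ne_top)
    have hl := tendsto_lintegral_inv_circleMap_sub_kadenCurve μ t₀ hp.1.le h
    have hl' := ENNReal.Tendsto.const_mul (a := annulusWeight p.1 p.2) hl
      (Or.inr ENNReal.ofReal_ne_top)
    simpa only [mul_zero] using ENNReal.Tendsto.const_mul hl' (Or.inr hfin)

/-- Proposition 4.6 and Corollary 4.7: continuity in time of the Kaden velocity in
`L²(B(0,r))`, and continuity of `t ↦ E_r(ω_t)` on `(0,∞)`. -/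
theorem stmt19 (μ : ℝ) (hμ : μ ∈ Set.Ioo (1 / 2 : ℝ) 1) (r : ℝ) (hr : 0 < r) :
    (∀ t₀ ∈ Set.Ioi (0 : ℝ),
      Tendsto (fun t : ℝ => ∫⁻ x in ball (0 : ℂ) r,
          (‖biotSavart (kadenMeasure μ t) x - biotSavart (kadenMeasure μ t₀) x‖₊ : ℝ≥0∞) ^ 2)
        (nhdsWithin t₀ (Set.Ioi 0)) (nhds 0)) ∧
    ContinuousOn (fun t : ℝ => localEnergy (kadenMeasure μ t) r) (Set.Ioi 0) := by
  have h (t₀ : ℝ) := (tendsto_setLIntegral_biotSavart_kadenMeasure_sub hμ r t₀).mono_left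
    (nhdsWithin_le_nhds (s := Set.Ioi 0))
  exact ⟨fun t₀ _ => h t₀, fun t₀ _ => tendsto_lintegral_enorm_sq_of_sub
    (fun t => (stronglyMeasurable_biotSavart_kadenMeasure μ t).aestronglyMeasurable)
    (stronglyMeasurable_biotSavart_kadenMeasure μ t₀).aestronglyMeasurable (h t₀)⟩
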